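/- arXiv:2309.09910 — 2 statements merged into one kernel-verified Lean document; each statement's English description precedes it below -/
import Mathlib

section
/- Embeddability of countable circular orders is a well-quasi-order: for every sequence (C_n)_{n ∈ ℕ} of circular orders on ℕ there exist n < m and an injective map f : ℕ → ℕ such that for all x, y, z ∈ ℕ, if x, y, z are in the betweenness relation of C_n then f(x), f(y), f(z) are in the betweenness relation of C_m. -/
/-- The betweenness relation of a circular order on `ℕ`, given as a term. -/
def cobtw (C : CircularOrder ℕ) : ℕ → ℕ → ℕ → Prop := C.btw

/-! ### Increasing sequences and the clopen Ramsey theorem -/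

namespace BetterQuasiOrder

/-- `u` is a strictly increasing sequence of elements of `A`. -/
def IncreasingIn (A : Set ℕ) (u : ℕ → ℕ) : Prop :=
  StrictMono u ∧ ∀ i, u i ∈ A

/-- The sequence `u` without its first term. -/
def tail (u : ℕ → ℕ) : ℕ → ℕ := fun n => u (n + 1)

/-- The sequence `u` with `a` put in front of it. -/
def cons (a : ℕ) (u : ℕ → ℕ) : ℕ → ℕ
  | 0 => a
  | n + 1 => u n

theorem cons_tail (u : ℕ → ℕ) : cons (u 0) (tail u) = u := by
  funext n
  cases n <;> rfl

theorem IncreasingIn.tail {A : Set ℕ} {u : ℕ → ℕ} (h : IncreasingIn A u) :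
    IncreasingIn A (tail u) :=
  ⟨fun _ _ hij => h.1 (Nat.succ_lt_succ hij), fun i => h.2 (i + 1)⟩

theorem IncreasingIn.mono {A B : Set ℕ} {u : ℕ → ℕ} (h : IncreasingIn A u) (hAB : A ⊆ B) :
    IncreasingIn B u :=
  ⟨h.1, fun i => hAB (h.2 i)⟩

theorem exists_increasingIn {A : Set ℕ} (hA : A.Infinite) : ∃ u, IncreasingIn A u :=
  ⟨Nat.nth (· ∈ A), Nat.nth_strictMono hA, fun i => Nat.nth_mem_of_infinite hA i⟩

/-- Every infinite set has an infinite subset on whose increasing sequences with the property `G`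
the colouring `c` is constant. -/
def Homogenizable (c : (ℕ → ℕ) → Bool) (G : (ℕ → ℕ) → Prop) : Prop :=
  ∀ A : Set ℕ, A.Infinite → ∃ B ⊆ A, B.Infinite ∧ ∃ e, ∀ u, IncreasingIn B u → G u → c u = e

theorem Homogenizable.of_cons {c : (ℕ → ℕ) → Bool} {G : (ℕ → ℕ) → Prop}
    (h : ∀ a, Homogenizable (fun u => c (cons a u)) (fun u => G (cons a u))) :
    Homogenizable c G := by
  intro A hA
  have step : ∀ S : {S : Set ℕ // S.Infinite}, ∃ a ∈ S.1, ∃ S' : {S : Set ℕ // S.Infinite},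
      S'.1 ⊆ S.1 ∩ Set.Ioi a ∧ ∃ e, ∀ u, IncreasingIn S'.1 u → G (cons a u) →
        c (cons a u) = e := by
    rintro ⟨S, hS⟩
    obtain ⟨a, ha⟩ := hS.nonempty
    have hS' : (S ∩ Set.Ioi a).Infinite := by
      refine Set.infinite_of_forall_exists_gt fun n => ?_
      obtain ⟨b, hb, hlt⟩ := hS.exists_gt (max a n)
      exact ⟨b, ⟨hb, (le_max_left _ _).trans_lt hlt⟩, (le_max_right _ _).trans_lt hlt⟩
    obtain ⟨B, hB, hBinf, e, he⟩ := h a _ hS'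
    exact ⟨a, ha, ⟨B, hBinf⟩, hB, e, he⟩
  choose a ha next hnext e he using step
  let S : ℕ → {S : Set ℕ // S.Infinite} := fun n => next^[n] ⟨A, hA⟩
  have hS : ∀ n, S (n + 1) = next (S n) := fun n => Function.iterate_succ_apply' _ _ _
  have hanti : Antitone fun n => (S n).1 := by
    refine antitone_nat_of_succ_le fun n => ?_
    rw [hS]
    exact (hnext _).trans Set.inter_subset_left
  have hlater : ∀ m n, m < n → a (S n) ∈ (next (S m)).1 := by
    intro m n hmn
    rw [← hS]
    exact hanti hmn (ha _)
  have hmono : StrictMono fun n => a (S n) :=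
    fun m n hmn => (hnext _ (hlater m n hmn)).2
  obtain ⟨d, hd⟩ := Finite.exists_infinite_fiber fun n => e (S n)
  refine ⟨Set.image (fun n => a (S n)) ((fun n => e (S n)) ⁻¹' {d}), ?_, ?_, d, ?_⟩
  · rintro _ ⟨n, -, rfl⟩
    exact hanti (Nat.zero_le n) (ha _)
  · exact (Set.infinite_coe_iff.1 hd).image hmono.injective.injOn
  · intro u hu hG
    obtain ⟨n, hn, hn0⟩ := hu.2 0
    rw [← cons_tail u, ← hn0] at hG ⊢
    rw [← show e (S n) = d from hn]
    refine he (S n) _ ⟨hu.tail.1, fun i => ?_⟩ hG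
    obtain ⟨m, -, hm⟩ := hu.2 (i + 1)
    have hlt : a (S n) < a (S m) := by
      have := hu.1 (Nat.succ_pos i)
      simp only at hn0 hm
      rw [hn0, hm]
      exact this
    rw [show tail u i = a (S m) from hm.symm]
    exact hlater n m (hmono.lt_iff_lt.1 hlt)

theorem Homogenizable.of_locally_constant {c : (ℕ → ℕ) → Bool} {G : (ℕ → ℕ) → Prop}
    (h : ∀ w : ℕ → ℕ, ∃ n e, ∀ v, (∀ i < n, v i = w i) → G v → c v = e) :
    Homogenizable c G := by
  by_contra hc
  let X := {φ : (ℕ → ℕ) → ℕ → ℕ // ¬ Homogenizable (fun u => c (φ u)) (fun u => G (φ u))}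
  have step : ∀ φ : X, ∃ a, ¬ Homogenizable (fun u => c (φ.1 (cons a u)))
      (fun u => G (φ.1 (cons a u))) := by
    intro φ
    by_contra! hφ
    exact φ.2 (Homogenizable.of_cons (c := fun u => c (φ.1 u)) (G := fun u => G (φ.1 u)) hφ)
  choose a ha using step
  let next : X → X := fun φ => ⟨fun u => φ.1 (cons (a φ) u), ha φ⟩
  let φ : ℕ → X := fun n => next^[n] ⟨id, hc⟩
  have hφ : ∀ n u, (φ (n + 1)).1 u = (φ n).1 (cons (a (φ n)) u) := by
    intro n u
    simp only [φ, Function.iterate_succ_apply']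
    rfl
  have hprefix : ∀ n u i, (φ n).1 u i = if i < n then a (φ i) else u (i - n) := by
    intro n
    induction n with
    | zero => intro u i; rfl
    | succ n ih =>
      intro u i
      rw [hφ, ih]
      rcases lt_trichotomy i n with hi | rfl | hi
      · simp [hi, hi.trans (Nat.lt_succ_self n)]
      · simp [cons]
      · obtain ⟨k, rfl⟩ := Nat.exists_eq_add_of_lt hi
        rw [if_neg (by omega), if_neg (by omega), show n + k + 1 - n = k + 1 by omega,
          show n + k + 1 - (n + 1) = k by omega]
        rfl
  obtain ⟨n, e, hn⟩ := h fun i => a (φ i)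
  refine (φ n).2 fun A hA => ⟨A, subset_rfl, hA, e, fun u _ hG => hn _ (fun i hi => ?_) hG⟩
  rw [hprefix, if_pos hi]

/-- The clopen Ramsey theorem. -/
theorem exists_homogeneous {A : Set ℕ} (hA : A.Infinite) (c : (ℕ → ℕ) → Bool)
    (hc : ∀ w, IncreasingIn A w →
      ∃ n, ∀ v, IncreasingIn A v → (∀ i ≤ n, w i = v i) → c v = c w) :
    ∃ B ⊆ A, B.Infinite ∧ ∃ e, ∀ u, IncreasingIn B u → c u = e := by
  have hom : Homogenizable c (IncreasingIn A) := by
    refine Homogenizable.of_locally_constant fun w => ?_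
    by_cases hw : IncreasingIn A w
    · obtain ⟨n, hn⟩ := hc w hw
      exact ⟨n + 1, c w, fun v hv hvA => hn v hvA fun i hi => (hv i (Nat.lt_succ_of_le hi)).symm⟩
    · have : ∃ n, ∀ v, (∀ i < n, v i = w i) → ¬ IncreasingIn A v := by
        by_contra! hcon
        refine hw ⟨strictMono_nat_of_lt_succ fun i => ?_, fun i => ?_⟩
        · obtain ⟨v, hv, hvA⟩ := hcon (i + 2)
          rw [← hv i (by omega), ← hv (i + 1) (by omega)]
          exact hvA.1 (Nat.lt_succ_self i)
        · obtain ⟨v, hv, hvA⟩ := hcon (i + 1)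
          rw [← hv i (by omega)]
          exact hvA.2 i
      obtain ⟨n, hn⟩ := this
      exact ⟨n, true, fun v hv hvA => absurd hvA (hn v hv)⟩
  obtain ⟨B, hBA, hB, e, he⟩ := hom A hA
  exact ⟨B, hBA, hB, e, fun u hu => he u hu (hu.mono hBA)⟩

/-! ### Bad arrays and the minimal bad array lemma -/

/-- Two strictly increasing sequences with initial segments that agree as sets agree there. -/
theorem agree_of_image_range_eq {u v : ℕ → ℕ} (hu : StrictMono u) (hv : StrictMono v) {k l : ℕ}
    (h : (Finset.range k).image u = (Finset.range l).image v) :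
    k = l ∧ ∀ i < k, u i = v i := by
  have hk : ((Finset.range k).image u).card = k := by
    rw [Finset.card_image_of_injective _ hu.injective, Finset.card_range]
  have hl : ((Finset.range l).image v).card = l := by
    rw [Finset.card_image_of_injective _ hv.injective, Finset.card_range]
  obtain rfl : k = l := by rw [← hk, h, hl]
  refine ⟨rfl, fun i hi => ?_⟩
  have h1 := Finset.orderEmbOfFin_unique hk (f := fun j : Fin k => u j)
    (fun j => Finset.mem_image_of_mem _ (Finset.mem_range.2 j.2)) fun _ _ hab => hu hab
  have h2 := Finset.orderEmbOfFin_unique hk (f := fun j : Fin k => v j)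
    (fun j => h ▸ Finset.mem_image_of_mem _ (Finset.mem_range.2 j.2)) fun _ _ hab => hv hab
  exact congrFun (h1.trans h2.symm) ⟨i, hi⟩

variable {Q : Type*}

/-- A bad array for the relation `le`: a function `val` on the increasing sequences of an infinite
set with `val u ≰ val (tail u)`, where the value at `u` is determined by the terms of `u` of index
at most `len u`. -/
structure BadArray (le : Q → Q → Prop) where
  /-- The infinite set on whose increasing sequences the array lives. -/
  dom : Set ℕ
  /-- The values of the array. -/
  val : (ℕ → ℕ) → Q
  /-- The index of the last term on which the value depends. -/
  len : (ℕ → ℕ) → ℕ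
  infinite : dom.Infinite
  congr : ∀ u v, IncreasingIn dom u → IncreasingIn dom v → (∀ i ≤ len u, u i = v i) →
    val v = val u ∧ len v = len u
  smooth : ∀ u, IncreasingIn dom u → len u ≤ len (tail u) + 1
  bad : ∀ u, IncreasingIn dom u → ¬ le (val u) (val (tail u))

namespace BadArray

variable {le lt : Q → Q → Prop}

/-- `p` refines `q`: it has a smaller domain, and the value may change only to a smaller one. -/
def Refines (lt : Q → Q → Prop) (p q : BadArray le) : Prop :=
  p.dom ⊆ q.dom ∧ ∀ u, IncreasingIn p.dom u → q.len u ≤ p.len u ∧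
    ((p.val u = q.val u ∧ p.len u = q.len u) ∨ lt (p.val u) (q.val u))

theorem Refines.refl (p : BadArray le) : Refines lt p p :=
  ⟨subset_rfl, fun _ _ => ⟨le_rfl, Or.inl ⟨rfl, rfl⟩⟩⟩

theorem Refines.trans (htrans : ∀ a b c, lt a b → lt b c → lt a c) {p q r : BadArray le}
    (hpq : Refines lt p q) (hqr : Refines lt q r) : Refines lt p r := by
  refine ⟨hpq.1.trans hqr.1, fun u hu => ?_⟩
  obtain ⟨h1, h2⟩ := hpq.2 u hu
  obtain ⟨h3, h4⟩ := hqr.2 u (hu.mono hpq.1)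
  refine ⟨h3.trans h1, ?_⟩
  rcases h2 with ⟨h2, h2'⟩ | h2
  · rw [h2, h2']
    exact h4
  · rcases h4 with ⟨h4, -⟩ | h4
    · exact Or.inr (h4 ▸ h2)
    · exact Or.inr (htrans _ _ _ h2 h4)

/-- The set of the terms of `u` on which the value at `u` depends. -/
def key (p : BadArray le) (u : ℕ → ℕ) : Finset ℕ :=
  (Finset.range (p.len u + 1)).image u

/-- Among refinements whose domain contains `F`, the value attached to the initial segment `s`
cannot be lowered any more. -/
def Stable (lt : Q → Q → Prop) (F s : Finset ℕ) (p : BadArray le) : Prop :=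
  ∀ q r : BadArray le, Refines lt r q → Refines lt q p → ↑F ⊆ r.dom →
    ∀ u, IncreasingIn r.dom u → q.key u = s → ¬ lt (r.val u) (q.val u)

theorem Stable.of_refines (htrans : ∀ a b c, lt a b → lt b c → lt a c) {F s : Finset ℕ}
    {p p' : BadArray le} (hp : Stable lt F s p) (h : Refines lt p' p) : Stable lt F s p' :=
  fun q r hrq hqp => hp q r hrq (hqp.trans htrans h)

theorem exists_stable (hwf : WellFounded lt) (htrans : ∀ a b c, lt a b → lt b c → lt a c)
    (F s : Finset ℕ) (p : BadArray le) (hF : ↑F ⊆ p.dom) :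
    ∃ p', Refines lt p' p ∧ ↑F ⊆ p'.dom ∧ Stable lt F s p' := by
  let V : Set Q := {x | ∃ q : BadArray le, Refines lt q p ∧ ↑F ⊆ q.dom ∧
    ∃ u, IncreasingIn q.dom u ∧ q.key u = s ∧ q.val u = x}
  by_cases hV : V.Nonempty
  · obtain ⟨x, ⟨q, hqp, hFq, w, hw, hws, rfl⟩, hmin⟩ := hwf.has_min V hV
    by_cases hq : Stable lt F s q
    · exact ⟨q, hqp, hFq, hq⟩
    simp only [Stable, not_forall, not_not] at hq
    obtain ⟨q₁, q₂, h21, h1q, hF2, u, hu, hus, hlt⟩ := hq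
    have hu1 := hu.mono h21.1
    have huq := hu1.mono h1q.1
    have h2p : Refines lt q₂ p := (h21.trans htrans h1q).trans htrans hqp
    have hlen1 := (h21.2 u hu).1
    obtain ⟨hlq, hagree⟩ := agree_of_image_range_eq hu1.1 hw.1 (hus.trans hws.symm)
    have hval : q₁.val u = q.val w ∨ lt (q₁.val u) (q.val w) := by
      have hqw := q.congr w u hw huq fun i hi => (hagree i (by omega)).symm
      rw [← hqw.1]
      exact (h1q.2 u hu1).2.imp And.left id
    have hdrop : lt (q₂.val u) (q.val w) := by
      rcases hval with h | h
      · exact h ▸ hlt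
      · exact htrans _ _ _ hlt h
    have hne : q₂.key u ≠ s := fun h => hmin _ ⟨q₂, h2p, hF2, u, hu, h, rfl⟩ hdrop
    refine ⟨q₂, h2p, hF2, fun r₁ r₂ h21' h12 _ v hv hvs _ => hne ?_⟩
    have hv1 := hv.mono h21'.1
    have hv2 := hv1.mono h12.1
    obtain ⟨hl, hag⟩ := agree_of_image_range_eq hv1.1 hu1.1 (hvs.trans hus.symm)
    have hlenv := (h12.2 v hv1).1
    have hcongr := (q₂.congr v u hv2 hu fun i hi => hag i (by omega)).2
    have : q₂.len u = q₁.len u := by omega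
    rw [key, this]
    exact hus
  · refine ⟨p, Refines.refl p, hF, fun q r hrq hqp hFr u hu hus _ => hV ?_⟩
    exact ⟨_, q, hqp, hFr.trans hrq.1, u, hu.mono hrq.1, hus, rfl⟩

theorem exists_stable_forall (hwf : WellFounded lt) (htrans : ∀ a b c, lt a b → lt b c → lt a c)
    (F : Finset ℕ) (𝒮 : Finset (Finset ℕ)) (p : BadArray le) (hF : ↑F ⊆ p.dom) :
    ∃ p', Refines lt p' p ∧ ↑F ⊆ p'.dom ∧ ∀ s ∈ 𝒮, Stable lt F s p' := by
  induction 𝒮 using Finset.induction_on with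
  | empty => exact ⟨p, Refines.refl p, hF, by simp⟩
  | insert s 𝒮 _ ih =>
    obtain ⟨p', hp', hF', hst⟩ := ih
    obtain ⟨p'', hp'', hF'', hst'⟩ := exists_stable hwf htrans F s p' hF'
    refine ⟨p'', hp''.trans htrans hp', hF'', fun t ht => ?_⟩
    rcases Finset.mem_insert.1 ht with rfl | ht
    · exact hst'
    · exact (hst t ht).of_refines htrans hp''

/-- A decreasing sequence of arrays whose domains have a common infinite subset has a common
refinement. -/
theorem exists_limit (hwf : WellFounded lt) {p : ℕ → BadArray le}
    (hp : ∀ m n, m ≤ n → Refines lt (p n) (p m)) {D : Set ℕ} (hD : D.Infinite)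
    (hDp : ∀ n, D ⊆ (p n).dom) :
    ∃ P : BadArray le, P.dom = D ∧ ∀ n, Refines lt P (p n) := by
  have hstab : ∀ u, ∃ N, IncreasingIn D u → ∀ n, N ≤ n →
      (p n).val u = (p N).val u ∧ (p n).len u = (p N).len u := by
    intro u
    obtain ⟨_, ⟨N, rfl⟩, hN⟩ := hwf.has_min (Set.range fun n => (p n).val u) (Set.range_nonempty _)
    refine ⟨N, fun hu n hn => ?_⟩
    exact (((hp N n hn).2 u (hu.mono (hDp n))).2).resolve_right (hN _ ⟨n, rfl⟩)
  choose N hN using hstab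
  refine ⟨⟨D, fun u => (p (N u)).val u, fun u => (p (N u)).len u, hD, ?_, ?_, ?_⟩, rfl, ?_⟩
  · intro u v hu hv huv
    have hv' := hN v hv (max (N u) (N v)) (le_max_right _ _)
    have hu' := hN u hu (max (N u) (N v)) (le_max_left _ _)
    have := (p (max (N u) (N v))).congr u v (hu.mono (hDp _)) (hv.mono (hDp _))
      (by rwa [hu'.2])
    exact ⟨by rw [← hv'.1, this.1, hu'.1], by rw [← hv'.2, this.2, hu'.2]⟩
  · intro u hu
    have hv' := hN _ hu.tail (max (N u) (N (tail u))) (le_max_right _ _)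
    have hu' := hN u hu (max (N u) (N (tail u))) (le_max_left _ _)
    have := (p (max (N u) (N (tail u)))).smooth u (hu.mono (hDp _))
    rwa [hv'.2, hu'.2] at this
  · intro u hu
    have hv' := hN _ hu.tail (max (N u) (N (tail u))) (le_max_right _ _)
    have hu' := hN u hu (max (N u) (N (tail u))) (le_max_left _ _)
    have := (p (max (N u) (N (tail u)))).bad u (hu.mono (hDp _))
    rwa [hv'.1, hu'.1] at this
  · intro n
    refine ⟨hDp n, fun u hu => ?_⟩
    have hu' := hN u hu (max (N u) n) (le_max_left _ _)
    have := (hp n (max (N u) n) (le_max_right _ _)).2 u (hu.mono (hDp _))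
    rwa [hu'.1, hu'.2] at this

/-- A refinement `R` of `P` can be amalgamated with `P` so that a finite subset of the domain of
`P` is kept. -/
theorem exists_amalgam (hle : ∀ a b c, le a b → lt b c → le a c) {P R : BadArray le}
    (hRP : Refines lt R P) {F : Finset ℕ} (hF : ↑F ⊆ P.dom) :
    ∃ h : BadArray le, Refines lt h P ∧ ↑F ⊆ h.dom ∧ R.dom ⊆ h.dom ∧
      ∀ u, IncreasingIn R.dom u → (∀ x ∈ F, x ≤ u (P.len u)) → h.val u = R.val u := by
  classical
  let cond : (ℕ → ℕ) → Prop := fun u =>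
    (∀ x ∈ F, x ≤ u (P.len u)) ∧ ∀ i ≤ P.len u, u i ∈ R.dom
  have hdom : ↑F ∪ R.dom ⊆ P.dom := Set.union_subset hF hRP.1
  have hR : ∀ u, IncreasingIn (↑F ∪ R.dom) u → cond u → IncreasingIn R.dom u := by
    refine fun u hu hc => ⟨hu.1, fun i => ?_⟩
    rcases le_or_gt i (P.len u) with hi | hi
    · exact hc.2 i hi
    · exact (hu.2 i).resolve_left fun hiF => absurd (hc.1 _ hiF) (not_le.2 (hu.1 hi))
  have hcongr : ∀ u v, IncreasingIn (↑F ∪ R.dom) u → IncreasingIn (↑F ∪ R.dom) v →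
      (∀ i ≤ P.len u, u i = v i) → (cond v ↔ cond u) := by
    intro u v hu hv huv
    have := (P.congr u v (hu.mono hdom) (hv.mono hdom) huv).2
    simp only [cond, this, huv _ le_rfl]
    refine and_congr_right fun _ => forall₂_congr fun i hi => ?_
    rw [huv i hi]
  have htail : ∀ u, IncreasingIn (↑F ∪ R.dom) u → cond u → cond (tail u) := by
    refine fun u hu hc => ⟨fun x hx => (hc.1 x hx).trans ?_, fun i _ => (hR u hu hc).2 (i + 1)⟩
    exact hu.1.monotone (P.smooth u (hu.mono hdom))
  let h : BadArray le :=
    { dom := ↑F ∪ R.dom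
      val := fun u => if cond u then R.val u else P.val u
      len := fun u => if cond u then R.len u else P.len u
      infinite := R.infinite.mono Set.subset_union_right
      congr := by
        intro u v hu hv huv
        by_cases hc : cond u
        · simp only [hc, if_true] at huv ⊢
          have hc' : cond v := (hcongr u v hu hv fun i hi =>
            huv i (hi.trans (hRP.2 u (hR u hu hc)).1)).2 hc
          simp only [hc', if_true]
          exact R.congr u v (hR u hu hc) (hR v hv hc') huv
        · simp only [hc, if_false] at huv ⊢
          have hc' : ¬ cond v := fun h => hc ((hcongr u v hu hv huv).1 h)
          simp only [hc', if_false]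
          exact P.congr u v (hu.mono hdom) (hv.mono hdom) huv
      smooth := by
        intro u hu
        by_cases hc : cond u
        · simp only [hc, htail u hu hc, if_true]
          exact R.smooth u (hR u hu hc)
        · simp only [hc, if_false]
          refine (P.smooth u (hu.mono hdom)).trans (Nat.succ_le_succ ?_)
          split_ifs with hc'
          · exact (hRP.2 _ (hR _ hu.tail hc')).1
          · exact le_rfl
      bad := by
        intro u hu
        by_cases hc : cond u
        · simp only [hc, htail u hu hc, if_true]
          exact R.bad u (hR u hu hc)
        · simp only [hc, if_false]
          have hbad := P.bad u (hu.mono hdom)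
          split_ifs with hc'
          · rcases (hRP.2 _ (hR _ hu.tail hc')).2 with ⟨h, -⟩ | h
            · rwa [h]
            · exact fun h' => hbad (hle _ _ _ h' h)
          · exact hbad }
  refine ⟨h, ⟨hdom, fun u hu => ?_⟩, Set.subset_union_left, Set.subset_union_right,
    fun u hu hFu => if_pos ⟨hFu, fun i _ => hu.2 i⟩⟩
  by_cases hc : cond u
  · simp only [h, hc, if_true]
    exact hRP.2 u (hR u hu hc)
  · simp [h, hc]

/-- The minimal bad array lemma. -/
theorem exists_minimal (hwf : WellFounded lt) (htrans : ∀ a b c, lt a b → lt b c → lt a c)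
    (hle : ∀ a b c, le a b → lt b c → le a c) (p₀ : BadArray le) :
    ∃ P : BadArray le, ∀ R : BadArray le, Refines lt R P →
      ∃ u, IncreasingIn R.dom u ∧ ¬ lt (R.val u) (P.val u) := by
  let X := {x : Finset ℕ × BadArray le // ↑x.1 ⊆ x.2.dom}
  have step : ∀ x : X, ∃ (a : ℕ) (y : X), y.1.1 = insert a x.1.1 ∧ (∀ b ∈ x.1.1, b < a) ∧
      Refines lt y.1.2 x.1.2 ∧ ∀ s ⊆ x.1.1, Stable lt x.1.1 s y.1.2 := by
    rintro ⟨⟨F, p⟩, hF⟩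
    obtain ⟨p', hp', hF', hst⟩ := exists_stable_forall hwf htrans F F.powerset p hF
    obtain ⟨a, ha, hlt⟩ := p'.infinite.exists_gt (F.sup id)
    refine ⟨a, ⟨⟨insert a F, p'⟩, ?_⟩, rfl, fun b hb => ?_, hp', fun s hs => ?_⟩
    · simpa [Set.insert_subset_iff] using ⟨ha, hF'⟩
    · exact (Finset.le_sup (f := id) hb).trans_lt hlt
    · exact hst s (Finset.mem_powerset.2 hs)
  choose a next hins hgt href hst using step
  let x : ℕ → X := fun n => next^[n] ⟨⟨∅, p₀⟩, by simp⟩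
  have hx : ∀ n, x (n + 1) = next (x n) := fun n => Function.iterate_succ_apply' _ _ _
  let b : ℕ → ℕ := fun n => a (x n)
  have hF : ∀ n, (x n).1.1 = (Finset.range n).image b := by
    intro n
    induction n with
    | zero => rfl
    | succ n ih => rw [hx, hins, ih, Finset.range_add_one, Finset.image_insert]
  have hb : StrictMono b := by
    refine strictMono_nat_of_lt_succ fun n => hgt _ _ ?_
    rw [hx, hins]
    exact Finset.mem_insert_self _ _
  have hp : ∀ m n, m ≤ n → Refines lt (x n).1.2 (x m).1.2 := by
    intro m n hmn
    induction n, hmn using Nat.le_induction with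
    | base => exact Refines.refl _
    | succ n _ ih =>
      refine Refines.trans htrans ?_ ih
      rw [hx]
      exact href _
  have hbF : ∀ m n, b m ∈ (x n).1.1 ↔ m < n := by
    intro m n
    rw [hF]
    simp [hb.injective.eq_iff]
  obtain ⟨P, hPdom, hP⟩ := exists_limit hwf hp (Set.infinite_range_of_injective hb.injective)
    (by
      rintro n _ ⟨m, rfl⟩
      have hmem : b m ∈ (x (max (m + 1) n)).1.1 := (hbF _ _).2 (by omega)
      exact (hp n _ (le_max_right _ _)).1 ((x _).2 hmem))
  refine ⟨P, fun R hRP => ?_⟩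
  by_contra! hdrop
  obtain ⟨u, hu⟩ := exists_increasingIn R.infinite
  have huP : ∀ i, ∃ k, b k = u i := fun i => by
    have := hRP.1 (hu.2 i)
    rwa [hPdom] at this
  obtain ⟨k, hk⟩ := huP (P.len u)
  have hFP : ↑(x (k + 1)).1.1 ⊆ P.dom := by
    rw [hF, hPdom]
    intro y hy
    obtain ⟨i, -, rfl⟩ := Finset.mem_image.1 (Finset.mem_coe.1 hy)
    exact ⟨i, rfl⟩
  have hle_last : ∀ y ∈ (x (k + 1)).1.1, y ≤ u (P.len u) := by
    intro y hy
    rw [hF] at hy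
    obtain ⟨j, hj, rfl⟩ := Finset.mem_image.1 hy
    rw [← hk]
    exact hb.monotone (Nat.lt_succ_iff.1 (Finset.mem_range.1 hj))
  obtain ⟨h, hhP, hFh, hRh, hval⟩ := exists_amalgam hle hRP hFP
  have hstable : Stable lt (x (k + 1)).1.1 (P.key u) (x (k + 2)).1.2 := by
    rw [hx (k + 1)]
    refine hst _ _ fun y hy => ?_
    obtain ⟨i, hi, rfl⟩ := Finset.mem_image.1 hy
    obtain ⟨j, hj⟩ := huP i
    rw [← hj, hbF, Nat.lt_succ_iff, ← hb.le_iff_le, hj, hk]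
    exact hu.1.monotone (Nat.lt_succ_iff.1 (Finset.mem_range.1 hi))
  refine hstable P h hhP (hP _) hFh u (hu.mono hRh) rfl ?_
  rw [hval u hu hle_last]
  exact hdrop u hu

end BadArray

end BetterQuasiOrder

/-! ### Signed trees -/

/-- Well-founded countably branching trees whose inner nodes carry a sign. They describe countable
scattered orders: a leaf is a point, and a node with sign `true` (resp. `false`) is an `ω`-sum
(resp. `ω*`-sum) in which every child occurs infinitely often. -/
inductive SignedTree : Type
  | leaf : SignedTree
  | node : Bool → (ℕ → SignedTree) → SignedTree

namespace SignedTree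

open BetterQuasiOrder

/-- The embeddability relation between signed trees. -/
inductive Le : SignedTree → SignedTree → Prop
  | leaf (t : SignedTree) : Le leaf t
  | child {s : SignedTree} (b : Bool) (c : ℕ → SignedTree) (j : ℕ) : Le s (c j) → Le s (node b c)
  | node (b : Bool) (c d : ℕ → SignedTree) (g : ℕ → ℕ) :
      (∀ i, Le (c i) (d (g i))) → Le (node b c) (node b d)

/-- `s` is a child of `t`. -/
inductive IsChild : SignedTree → SignedTree → Prop
  | mk (b : Bool) (c : ℕ → SignedTree) (i : ℕ) : IsChild (c i) (node b c)

theorem wellFounded_isChild : WellFounded IsChild := by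
  refine ⟨fun t => ?_⟩
  induction t with
  | leaf => exact ⟨_, fun s hs => nomatch hs⟩
  | node b c ih =>
    refine ⟨_, fun s hs => ?_⟩
    cases hs with
    | mk _ _ i => exact ih i

theorem Le.of_transGen {s t t' : SignedTree} (h : Le s t) (ht : Relation.TransGen IsChild t t') :
    Le s t' := by
  induction ht with
  | single hc =>
    cases hc with
    | mk b c i => exact Le.child b c i h
  | tail _ hc ih =>
    cases hc with
    | mk b c i => exact Le.child b c i ih

/-- The sign of the root. -/
def sign : SignedTree → Bool
  | leaf => true
  | node b _ => b

/-- If `s ≰ t` and the roots have the same sign, then some child of `s` is below no child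
of `t`. -/
theorem exists_child_of_not_le {s t : SignedTree} (h : ¬ Le s t) (hst : s.sign = t.sign) :
    ∃ s', IsChild s' s ∧ ∀ t', IsChild t' t → ¬ Le s' t' := by
  cases s with
  | leaf => exact absurd (Le.leaf t) h
  | node b c =>
    cases t with
    | leaf => exact ⟨c 0, IsChild.mk b c 0, fun t' ht' => nomatch ht'⟩
    | node b' d =>
      obtain rfl : b = b' := hst
      by_contra! hcon
      have : ∀ i, ∃ j, Le (c i) (d j) := fun i => by
        obtain ⟨_, ⟨⟩, ht⟩ := hcon (c i) (IsChild.mk b c i)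
        exact ⟨_, ht⟩
      choose g hg using this
      exact h (Le.node b c d g hg)

/-- Every bad array of signed trees has a refinement all of whose values are smaller. -/
theorem exists_refines_lt (P : BadArray Le) :
    ∃ R : BadArray Le, R.Refines (Relation.TransGen IsChild) P ∧
      ∀ u, IncreasingIn R.dom u → Relation.TransGen IsChild (R.val u) (P.val u) := by
  obtain ⟨B, hBP, hB, e, he⟩ := exists_homogeneous P.infinite (fun u => (P.val u).sign)
    fun w hw => ⟨P.len w, fun v hv hwv => by rw [(P.congr w v hw hv hwv).1]⟩
  have hnext : ∀ s t : SignedTree, ∃ s', ¬ Le s t → s.sign = t.sign →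
      IsChild s' s ∧ ∀ t', IsChild t' t → ¬ Le s' t' := by
    intro s t
    by_cases h : ¬ Le s t ∧ s.sign = t.sign
    · obtain ⟨s', hs'⟩ := exists_child_of_not_le h.1 h.2
      exact ⟨s', fun _ _ => hs'⟩
    · exact ⟨leaf, fun h1 h2 => absurd ⟨h1, h2⟩ h⟩
  choose next hnext using hnext
  have hval : ∀ u, IncreasingIn B u →
      IsChild (next (P.val u) (P.val (tail u))) (P.val u) ∧
      ∀ t', IsChild t' (P.val (tail u)) → ¬ Le (next (P.val u) (P.val (tail u))) t' :=
    fun u hu => hnext _ _ (P.bad u (hu.mono hBP)) ((he u hu).trans (he _ hu.tail).symm)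
  refine ⟨⟨B, fun u => next (P.val u) (P.val (tail u)), fun u => P.len (tail u) + 1, hB, ?_, ?_, ?_⟩,
    ⟨hBP, fun u hu => ⟨P.smooth u (hu.mono hBP), Or.inr (.single (hval u hu).1)⟩⟩,
    fun u hu => .single (hval u hu).1⟩
  · intro u v hu hv huv
    have h1 := P.congr u v (hu.mono hBP) (hv.mono hBP)
      fun i hi => huv i (hi.trans (P.smooth u (hu.mono hBP)))
    have h2 := P.congr _ _ (hu.mono hBP).tail (hv.mono hBP).tail
      fun i hi => huv (i + 1) (Nat.succ_le_succ hi)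
    simp only [h1.1, h2.1, h2.2, and_self]
  · intro u hu
    exact Nat.succ_le_succ (P.smooth _ (hu.mono hBP).tail)
  · intro u hu
    exact (hval u hu).2 _ (hval _ hu.tail).1

/-- Signed trees are well-quasi-ordered. -/
theorem wellQuasiOrdered_le : WellQuasiOrdered Le := by
  intro q
  by_contra! hbad
  let p₀ : BadArray Le :=
    { dom := Set.univ
      val := fun u => q (u 0)
      len := fun _ => 0
      infinite := Set.infinite_univ
      congr := fun u v _ _ huv => ⟨by rw [huv 0 le_rfl], rfl⟩
      smooth := fun _ _ => Nat.zero_le _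
      bad := fun u hu => hbad _ _ (hu.1 Nat.zero_lt_one) }
  obtain ⟨P, hP⟩ := BadArray.exists_minimal (le := Le) (lt := Relation.TransGen IsChild)
    wellFounded_isChild.transGen (fun _ _ _ => Relation.TransGen.trans)
    (fun _ _ _ => Le.of_transGen) p₀
  obtain ⟨R, hRP, hR⟩ := exists_refines_lt P
  obtain ⟨u, hu, hnot⟩ := hP R hRP
  exact hnot (hR u hu)

/-! ### Sets of rationals described by signed trees -/

/-- `A` embeds into `B` as a linear order. -/
def Embeds (A B : Set ℚ) : Prop :=
  ∃ f : ℚ → ℚ, StrictMonoOn f A ∧ Set.MapsTo f A B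

/-- The order on `ℚ` or its reverse, according to the sign. -/
def Prec (b : Bool) (x y : ℚ) : Prop :=
  if b then x < y else y < x

theorem Prec.trans {b : Bool} {x y z : ℚ} (h : Prec b x y) (h' : Prec b y z) : Prec b x z := by
  cases b
  · exact lt_trans (a := z) h' h
  · exact lt_trans (b := y) h h'

theorem not_prec_self (b : Bool) (x : ℚ) : ¬ Prec b x x := by
  cases b <;> simp [Prec]

theorem Prec.not_prec {b : Bool} {x y : ℚ} (h : Prec b x y) : ¬ Prec b y x :=
  fun h' => not_prec_self b x (h.trans h')

theorem prec_trichotomy (b : Bool) (x y : ℚ) : Prec b x y ∨ x = y ∨ Prec b y x := by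
  cases b
  · exact (lt_trichotomy y x).imp_right (Or.imp_left Eq.symm)
  · exact lt_trichotomy x y

/-- `A` embeds into the order described by the tree. -/
def EmbedsInto : SignedTree → Set ℚ → Prop
  | leaf, A => A.Subsingleton
  | node b c, A => ∃ π : ℚ → ℕ, (∀ x ∈ A, ∀ y ∈ A, π x < π y → Prec b x y) ∧
      ∀ n, ∃ i, EmbedsInto (c i) (A ∩ π ⁻¹' {n})

/-- The order described by the tree embeds into `A`. -/
def EmbeddedIn : SignedTree → Set ℚ → Prop
  | leaf, A => A.Nonempty
  | node b c, A => ∃ P : ℕ → Set ℚ, (∀ n, P n ⊆ A) ∧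
      (∀ m n, m < n → ∀ x ∈ P m, ∀ y ∈ P n, Prec b x y) ∧
      ∀ i N, ∃ n ≥ N, EmbeddedIn (c i) (P n)

theorem EmbedsInto.of_subsingleton (t : SignedTree) {A : Set ℚ} (hA : A.Subsingleton) :
    EmbedsInto t A := by
  induction t generalizing A with
  | leaf => exact hA
  | node b c ih =>
    exact ⟨fun _ => 0, fun _ _ _ _ h => absurd h (lt_irrefl 0),
      fun n => ⟨0, ih 0 (hA.anti Set.inter_subset_left)⟩⟩

theorem EmbedsInto.of_le {s t : SignedTree} (h : Le s t) {A : Set ℚ} (hA : EmbedsInto s A) :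
    EmbedsInto t A := by
  induction h generalizing A with
  | leaf t => exact EmbedsInto.of_subsingleton t hA
  | child b c j _ ih =>
    refine ⟨fun _ => 0, fun _ _ _ _ h => absurd h (lt_irrefl 0), fun n => ⟨j, ?_⟩⟩
    by_cases hn : n = 0
    · subst hn
      simpa using ih hA
    · refine EmbedsInto.of_subsingleton _ ?_
      simp [Ne.symm hn]
  | node b c d g _ ih =>
    obtain ⟨π, hπ, hfib⟩ := hA
    refine ⟨π, hπ, fun n => ?_⟩
    obtain ⟨i, hi⟩ := hfib n
    exact ⟨g i, ih i hi⟩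

theorem EmbeddedIn.mono {t : SignedTree} {A B : Set ℚ} (hA : EmbeddedIn t A) (hAB : A ⊆ B) :
    EmbeddedIn t B := by
  cases t with
  | leaf => exact Set.Nonempty.mono hAB hA
  | node b c =>
    obtain ⟨P, hP, h⟩ := hA
    exact ⟨P, fun n => (hP n).trans hAB, h⟩

theorem EmbeddedIn.nonempty {t : SignedTree} {A : Set ℚ} (hA : EmbeddedIn t A) : A.Nonempty := by
  induction t generalizing A with
  | leaf => exact hA
  | node b c ih =>
    obtain ⟨P, hP, -, h⟩ := hA
    obtain ⟨n, -, hn⟩ := h 0 0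
    exact (ih 0 hn).mono (hP n)

theorem EmbeddedIn.of_le {s t : SignedTree} (h : Le s t) {A : Set ℚ} (hA : EmbeddedIn t A) :
    EmbeddedIn s A := by
  induction h generalizing A with
  | leaf t => exact hA.nonempty
  | child b c j _ ih =>
    obtain ⟨P, hP, -, h⟩ := hA
    obtain ⟨n, -, hn⟩ := h j 0
    exact ih (hn.mono (hP n))
  | node b c d g _ ih =>
    obtain ⟨P, hP, hlt, h⟩ := hA
    refine ⟨P, hP, hlt, fun i N => ?_⟩
    obtain ⟨n, hn, hin⟩ := h (g i) N
    exact ⟨n, hn, ih i hin⟩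

/-- If `A` embeds into the order described by `t`, and that order embeds into `B`, then `A` embeds
into `B`. -/
theorem EmbedsInto.embeds {t : SignedTree} {A B : Set ℚ} (hA : EmbedsInto t A)
    (hB : EmbeddedIn t B) : Embeds A B := by
  induction t generalizing A B with
  | leaf =>
    obtain ⟨b, hb⟩ := hB
    exact ⟨fun _ => b, fun x hx y hy hxy => absurd (hA hx hy) hxy.ne, fun _ _ => hb⟩
  | node b c ih =>
    obtain ⟨π, hπ, hfib⟩ := hA
    obtain ⟨P, hP, hlt, h⟩ := hB
    choose i hi using hfib
    choose g hg hgP using h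
    let k : ℕ → ℕ := fun n => Nat.rec (g (i 0) 0) (fun m r => g (i (m + 1)) (r + 1)) n
    have hk : StrictMono k := strictMono_nat_of_lt_succ fun n => hg (i (n + 1)) (k n + 1)
    have hkP : ∀ n, EmbeddedIn (c (i n)) (P (k n)) := by
      intro n
      cases n with
      | zero => exact hgP _ _
      | succ n => exact hgP _ _
    choose f hf hfP using fun n => ih (i n) (hi n) (hkP n)
    have hmem : ∀ x ∈ A, f (π x) x ∈ P (k (π x)) := fun x hx => hfP _ ⟨hx, rfl⟩
    refine ⟨fun x => f (π x) x, fun x hx y hy hxy => ?_, fun x hx => hP _ (hmem x hx)⟩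
    rcases lt_trichotomy (π x) (π y) with h | h | h
    · have h1 := hπ x hx y hy h
      have h2 := hlt _ _ (hk h) _ (hmem x hx) _ (hmem y hy)
      cases b
      · exact absurd hxy (not_lt_of_gt h1)
      · exact h2
    · simp only [h]
      exact hf (π y) ⟨hx, h⟩ ⟨hy, rfl⟩ hxy
    · have h1 := hπ y hy x hx h
      have h2 := hlt _ _ (hk h) _ (hmem y hy) _ (hmem x hx)
      cases b
      · exact h2
      · exact absurd hxy (not_lt_of_gt h1)

/-- `A` is equimorphic to the order described by `t`. -/
def Describes (t : SignedTree) (A : Set ℚ) : Prop :=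
  EmbedsInto t A ∧ EmbeddedIn t A

/-- `A` is a finite sum of sets described by the trees in the list. -/
def Decomposes : List SignedTree → Set ℚ → Prop
  | [], A => A = ∅
  | t :: l, A => ∃ B C, A = B ∪ C ∧ (∀ x ∈ B, ∀ y ∈ C, x < y) ∧ Describes t B ∧ Decomposes l C

/-- `A` is a finite sum of sets described by signed trees. -/
def Decomposable (A : Set ℚ) : Prop :=
  ∃ l, Decomposes l A

theorem decomposable_empty : Decomposable ∅ :=
  ⟨[], rfl⟩

theorem Describes.decomposable {t : SignedTree} {A : Set ℚ} (h : Describes t A) :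
    Decomposable A :=
  ⟨[t], A, ∅, by simp, by simp, h, rfl⟩

theorem Decomposable.of_subsingleton {A : Set ℚ} (h : A.Subsingleton) : Decomposable A := by
  rcases A.eq_empty_or_nonempty with rfl | hne
  · exact decomposable_empty
  · exact Describes.decomposable (t := leaf) ⟨h, hne⟩

theorem Decomposable.union {A B : Set ℚ} (hA : Decomposable A) (hB : Decomposable B)
    (hAB : ∀ x ∈ A, ∀ y ∈ B, x < y) : Decomposable (A ∪ B) := by
  obtain ⟨l, hl⟩ := hA
  induction l generalizing A with
  | nil =>
    obtain rfl : A = ∅ := hl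
    simpa using hB
  | cons t l ih =>
    obtain ⟨A₁, A₂, rfl, h12, ht, hl⟩ := hl
    obtain ⟨l', hl'⟩ := ih (fun x hx y hy => hAB x (Or.inr hx) y hy) hl
    refine ⟨t :: l', A₁, A₂ ∪ B, Set.union_assoc _ _ _, ?_, ht, hl'⟩
    rintro x hx y (hy | hy)
    · exact h12 x hx y hy
    · exact hAB x (Or.inl hx) y hy

theorem Decomposable.union_of_prec (b : Bool) {A B : Set ℚ} (hA : Decomposable A)
    (hB : Decomposable B) (hAB : ∀ x ∈ A, ∀ y ∈ B, Prec b x y) : Decomposable (A ∪ B) := by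
  cases b
  · rw [Set.union_comm]
    exact hB.union hA fun x hx y hy => hAB y hy x hx
  · exact hA.union hB hAB

/-- A decomposable set is cut into finitely many described pieces, enumerated in the direction
given by the sign. -/
theorem Decomposable.exists_pieces (b : Bool) {A : Set ℚ} (hA : Decomposable A) :
    ∃ (N : ℕ) (π : ℚ → ℕ), (∀ x ∈ A, π x < N) ∧
      (∀ x ∈ A, ∀ y ∈ A, π x < π y → Prec b x y) ∧
      ∀ j < N, ∃ t, Describes t (A ∩ π ⁻¹' {j}) := by
  classical
  have key : ∃ (N : ℕ) (π : ℚ → ℕ), (∀ x ∈ A, π x < N) ∧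
      (∀ x ∈ A, ∀ y ∈ A, π x < π y → x < y) ∧ ∀ j < N, ∃ t, Describes t (A ∩ π ⁻¹' {j}) := by
    obtain ⟨l, hl⟩ := hA
    induction l generalizing A with
    | nil =>
      obtain rfl : A = ∅ := hl
      exact ⟨0, fun _ => 0, by simp, by simp, by simp⟩
    | cons t l ih =>
      obtain ⟨B, C, rfl, hBC, ht, hC⟩ := hl
      obtain ⟨N, π, hπN, hπ, hfib⟩ := ih hC
      have hnot : ∀ x ∈ C, x ∉ B := fun x hx hxB => lt_irrefl x (hBC x hxB x hx)
      refine ⟨N + 1, fun x => if x ∈ B then 0 else π x + 1, ?_, ?_, ?_⟩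
      · rintro x (hx | hx)
        · simp [hx]
        · simpa [hnot x hx] using hπN x hx
      · rintro x (hx | hx) y (hy | hy) hxy
        · simp [hx, hy] at hxy
        · exact hBC x hx y hy
        · simp [hy] at hxy
        · simp only [hnot x hx, hnot y hy, if_false] at hxy
          exact hπ x hx y hy (by omega)
      · intro j hj
        cases j with
        | zero =>
          refine ⟨t, ?_⟩
          convert ht using 1
          ext x
          by_cases hx : x ∈ B <;> simp [hx]
        | succ j =>
          obtain ⟨t', ht'⟩ := hfib j (by omega)
          refine ⟨t', ?_⟩
          convert ht' using 1
          ext x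
          by_cases hx : x ∈ B
          · have hxC : x ∉ C := fun h => hnot x h hx
            simp [hx, hxC]
          · simp [hx]
  cases b with
  | true => exact key
  | false =>
    obtain ⟨N, π, hπN, hπ, hfib⟩ := key
    refine ⟨N, fun x => N - 1 - π x, fun x hx => ?_, fun x hx y hy hxy => ?_, fun j hj => ?_⟩
    · have := hπN x hx
      change N - 1 - π x < N
      omega
    · change N - 1 - π x < N - 1 - π y at hxy
      exact hπ y hy x hx (by omega)
    · obtain ⟨t, ht⟩ := hfib (N - 1 - j) (by omega)
      refine ⟨t, ?_⟩
      convert ht using 1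
      ext x
      simp only [Set.mem_inter_iff, Set.mem_preimage, Set.mem_singleton_iff]
      refine and_congr_right fun hx => ?_
      have := hπN x hx
      omega

theorem Decomposable.of_finite_fibers (b : Bool) {A : Set ℚ} {π : ℚ → ℕ}
    (hπ : ∀ x ∈ A, ∀ y ∈ A, π x < π y → Prec b x y)
    (hfib : ∀ n, Decomposable (A ∩ π ⁻¹' {n})) (N : ℕ) :
    Decomposable (A ∩ {x | π x < N}) := by
  induction N with
  | zero => simpa using decomposable_empty
  | succ N ih =>
    have : A ∩ {x | π x < N + 1} = A ∩ {x | π x < N} ∪ A ∩ π ⁻¹' {N} := by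
      ext x
      simp only [Set.mem_inter_iff, Set.mem_ofPred_eq, Set.mem_union, Set.mem_preimage,
        Set.mem_singleton_iff, Nat.lt_succ_iff_lt_or_eq]
      tauto
    rw [this]
    refine ih.union_of_prec b (hfib N) ?_
    rintro x ⟨hx, hxN⟩ y ⟨hy, rfl⟩
    exact hπ x hx y hy hxN

/-- From some point on, every tree of a sequence is below infinitely many trees of it. -/
theorem exists_forall_frequently_le (T : ℕ → SignedTree) :
    ∃ N, ∀ n ≥ N, ∀ M, ∃ m ≥ M, Le (T n) (T m) := by
  by_contra! h
  choose n hn M hM using h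
  let k : ℕ → ℕ := fun i => Nat.rec 0 (fun _ r => max (M r) (n r + 1)) i
  have hk : ∀ i, k (i + 1) = max (M (k i)) (n (k i) + 1) := fun _ => rfl
  have hmono : Monotone k := monotone_nat_of_le_succ fun i => by
    rw [hk]
    exact (hn (k i)).trans ((Nat.le_succ _).trans (le_max_right _ _))
  obtain ⟨i, j, hij, hle⟩ := wellQuasiOrdered_le fun i => T (n (k i))
  refine hM (k i) (n (k j)) ?_ hle
  calc M (k i) ≤ k (i + 1) := le_max_left _ _
    _ ≤ k j := hmono hij
    _ ≤ n (k j) := hn _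

/-- A sum of described sets along `ω` or `ω*` is decomposable. -/
theorem Decomposable.of_describes (b : Bool) {A : Set ℚ} {π : ℚ → ℕ}
    (hπ : ∀ x ∈ A, ∀ y ∈ A, π x < π y → Prec b x y)
    (hfib : ∀ n, ∃ t, Describes t (A ∩ π ⁻¹' {n})) : Decomposable A := by
  choose T hT using hfib
  obtain ⟨N, hN⟩ := exists_forall_frequently_le T
  have hA : A = A ∩ {x | π x < N} ∪ A ∩ {x | N ≤ π x} := by
    rw [← Set.inter_union_distrib_left]
    refine (Set.inter_eq_left.2 fun x _ => ?_).symm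
    exact lt_or_ge (π x) N
  rw [hA]
  refine Decomposable.union_of_prec b (Decomposable.of_finite_fibers b hπ
    (fun n => (hT n).decomposable) N) (Describes.decomposable
    (t := node b fun i => T (N + i)) ⟨?_, ?_⟩) ?_
  · refine ⟨fun x => π x - N, ?_, fun n => ⟨n, ?_⟩⟩
    · rintro x ⟨hx, hxN⟩ y ⟨hy, hyN⟩ hxy
      change π x - N < π y - N at hxy
      exact hπ x hx y hy (by omega)
    · convert (hT (N + n)).1 using 1
      ext x
      simp only [Set.mem_inter_iff, Set.mem_ofPred_eq, Set.mem_preimage, Set.mem_singleton_iff,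
        and_assoc]
      refine and_congr_right fun _ => ?_
      omega
  · refine ⟨fun n => A ∩ π ⁻¹' {N + n}, ?_, ?_, fun i M => ?_⟩
    · rintro n x ⟨hx, hxn⟩
      refine ⟨hx, ?_⟩
      rw [Set.mem_preimage, Set.mem_singleton_iff] at hxn
      exact (Nat.le_add_right N n).trans_eq hxn.symm
    · rintro m n hmn x ⟨hx, hxm⟩ y ⟨hy, hyn⟩
      rw [Set.mem_preimage, Set.mem_singleton_iff] at hxm hyn
      exact hπ x hx y hy (by omega)
    · obtain ⟨m, hm, hle⟩ := hN (N + i) (Nat.le_add_right N i) (N + M)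
      obtain ⟨d, rfl⟩ := Nat.exists_eq_add_of_le ((Nat.le_add_right N M).trans hm)
      exact ⟨d, by omega, (hT _).2.of_le hle⟩
  · rintro x ⟨hx, hxN⟩ y ⟨hy, hyN⟩
    exact hπ x hx y hy (lt_of_lt_of_le hxN hyN)

theorem exists_mem_block {N : ℕ → ℕ} (hN : ∀ n, 0 < N n) (k : ℕ) :
    ∃ n j, j < N n ∧ k = ∑ i ∈ Finset.range n, N i + j := by
  induction k with
  | zero => exact ⟨0, 0, hN 0, by simp⟩
  | succ k ih =>
    obtain ⟨n, j, hj, rfl⟩ := ih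
    by_cases h : j + 1 < N n
    · exact ⟨n, j + 1, h, by omega⟩
    · exact ⟨n + 1, 0, hN _, by rw [Finset.sum_range_succ]; omega⟩

/-- A sum of nonempty decomposable sets along `ω` or `ω*` is decomposable. -/
theorem Decomposable.of_fibers (b : Bool) {A : Set ℚ} {π : ℚ → ℕ}
    (hπ : ∀ x ∈ A, ∀ y ∈ A, π x < π y → Prec b x y)
    (hfib : ∀ n, Decomposable (A ∩ π ⁻¹' {n})) (hne : ∀ n, (A ∩ π ⁻¹' {n}).Nonempty) :
    Decomposable A := by
  choose N ρ hρN hρ hpiece using fun n => (hfib n).exists_pieces b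
  have hpos : ∀ n, 0 < N n := fun n => by
    obtain ⟨x, hx⟩ := hne n
    exact (Nat.zero_le _).trans_lt (hρN n x hx)
  let off : ℕ → ℕ := fun n => ∑ i ∈ Finset.range n, N i
  have hsucc : ∀ n, off (n + 1) = off n + N n := fun n => Finset.sum_range_succ _ _
  have hoff : Monotone off := monotone_nat_of_le_succ fun n => by
    rw [hsucc]
    exact Nat.le_add_right _ _
  have hlt : ∀ m n j, m < n → j < N m → off m + j < off n := fun m n j hmn hj =>
    calc off m + j < off m + N m := Nat.add_lt_add_left hj _
      _ = off (m + 1) := (hsucc m).symm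
      _ ≤ off n := hoff hmn
  have hρN' : ∀ x ∈ A, ρ (π x) x < N (π x) := fun x hx => hρN _ x ⟨hx, rfl⟩
  refine Decomposable.of_describes b (π := fun x => off (π x) + ρ (π x) x) ?_ fun k => ?_
  · intro x hx y hy hxy
    rcases lt_trichotomy (π x) (π y) with h | h | h
    · exact hπ x hx y hy h
    · refine hρ (π y) x ⟨hx, h⟩ y ⟨hy, rfl⟩ ?_
      simp only [h] at hxy
      omega
    · have := hlt _ _ _ h (hρN' y hy)
      omega
  · obtain ⟨n, j, hj, rfl⟩ := exists_mem_block hpos k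
    obtain ⟨t, ht⟩ := hpiece n j hj
    refine ⟨t, ?_⟩
    convert ht using 1
    ext x
    simp only [Set.mem_inter_iff, Set.mem_preimage, Set.mem_singleton_iff, and_assoc]
    refine and_congr_right fun hx => ⟨fun h => ?_, fun ⟨h, h'⟩ => by rw [h, h']⟩
    change off (π x) + ρ (π x) x = off n + j at h
    rcases lt_trichotomy (π x) n with h' | rfl | h'
    · have := hlt _ _ _ h' (hρN' x hx)
      omega
    · exact ⟨rfl, by omega⟩
    · have := hlt _ _ _ h' hj
      omega


/-! ### Sets of rationals without a dense subset are decomposable -/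

/-- If all proper `b`-initial parts of `E` are decomposable, then so is `E`. -/
theorem Decomposable.of_bounded (b : Bool) {E : Set ℚ}
    (hE : ∀ y ∈ E, ∀ D ⊆ E, (∀ z ∈ D, ¬ Prec b y z) → Decomposable D) : Decomposable E := by
  rcases E.eq_empty_or_nonempty with rfl | ⟨x, hx⟩
  · exact decomposable_empty
  by_cases hmax : ∃ y ∈ E, ∀ z ∈ E, ¬ Prec b y z
  · obtain ⟨y, hy, h⟩ := hmax
    exact hE y hy E subset_rfl h
  push Not at hmax
  have step : ∀ (y : E) (q : ℚ), ∃ z : E, Prec b y z ∧ (q ∈ E → Prec b q z) := by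
    rintro ⟨y, hy⟩ q
    obtain ⟨z, hz, hyz⟩ := hmax y hy
    by_cases hq : q ∈ E
    · rcases prec_trichotomy b q z with h | rfl | h
      · exact ⟨⟨z, hz⟩, hyz, fun _ => h⟩
      · obtain ⟨w, hw, hqw⟩ := hmax q hq
        exact ⟨⟨w, hw⟩, hyz.trans hqw, fun _ => hqw⟩
      · obtain ⟨w, hw, hqw⟩ := hmax q hq
        exact ⟨⟨w, hw⟩, (hyz.trans h).trans hqw, fun _ => hqw⟩
    · exact ⟨⟨z, hz⟩, hyz, fun h => absurd h hq⟩
  choose next hnext hnext' using step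
  obtain ⟨e, he⟩ := exists_surjective_nat ℚ
  let u : ℕ → E := fun n => Nat.rec ⟨x, hx⟩ (fun n y => next y (e n)) n
  have hu : ∀ n : ℕ, Prec b (u n).1 (u (n + 1)).1 := fun n => hnext (u n) (e n)
  have hlt : ∀ m n : ℕ, m < n → Prec b (u m).1 (u n).1 := by
    intro m n hmn
    induction n, hmn using Nat.le_induction with
    | base => exact hu m
    | succ n _ ih => exact ih.trans (hu n)
  have hcof : ∀ y ∈ E, {n | Prec b y (u (n + 1))}.Nonempty := by
    intro y hy
    obtain ⟨n, rfl⟩ := he y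
    exact ⟨n, hnext' (u n) (e n) hy⟩
  let π : ℚ → ℕ := fun y => sInf {n | Prec b y (u (n + 1))}
  have hmem : ∀ y ∈ E, Prec b y (u (π y + 1)) := fun y hy => Nat.sInf_mem (hcof y hy)
  refine Decomposable.of_fibers b (π := π) ?_ ?_ ?_
  · intro y hy z _ hyz
    have h : ¬ Prec b z (u (π y + 1)) := Nat.notMem_of_lt_sInf hyz
    rcases prec_trichotomy b z (u (π y + 1)) with h' | h' | h'
    · exact absurd h' h
    · exact h' ▸ hmem y hy
    · exact (hmem y hy).trans h'
  · intro n
    refine hE _ (u (n + 1)).2 _ Set.inter_subset_left ?_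
    rintro z ⟨hz, rfl⟩
    exact (hmem z hz).not_prec
  · intro n
    refine ⟨(u n).1, (u n).2, ?_⟩
    refine le_antisymm (Nat.sInf_le (hu n)) (not_lt.1 fun h => ?_)
    have h' := hmem _ (u n).2
    rcases (Nat.succ_le_of_lt h).lt_or_eq with h'' | h''
    · exact h'.not_prec (hlt _ _ h'')
    · refine not_prec_self b (u n).1 ?_
      rw [Nat.succ_eq_add_one] at h''
      rwa [h''] at h'

/-- Every subset of `A` is decomposable. -/
def HereditarilyDecomposable (A : Set ℚ) : Prop :=
  ∀ B ⊆ A, Decomposable B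

namespace HereditarilyDecomposable

theorem mono {A B : Set ℚ} (hB : HereditarilyDecomposable B) (h : A ⊆ B) :
    HereditarilyDecomposable A :=
  fun C hC => hB C (hC.trans h)

theorem union {A B : Set ℚ} (hA : HereditarilyDecomposable A) (hB : HereditarilyDecomposable B)
    (hAB : ∀ x ∈ A, ∀ y ∈ B, x < y) : HereditarilyDecomposable (A ∪ B) := by
  intro C hC
  rw [← Set.inter_eq_left.2 hC, Set.inter_union_distrib_left]
  exact (hA _ Set.inter_subset_right).union (hB _ Set.inter_subset_right)
    fun x hx y hy => hAB x hx.2 y hy.2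

theorem of_split {A : Set ℚ} (y : ℚ) (h₁ : HereditarilyDecomposable (A ∩ Set.Iio y))
    (h₂ : HereditarilyDecomposable (A ∩ Set.Ici y)) : HereditarilyDecomposable A := by
  refine (h₁.union h₂ fun x hx z hz => lt_of_lt_of_le hx.2 hz.2).mono fun x hx => ?_
  exact (lt_or_ge x y).imp (fun h => ⟨hx, h⟩) fun h => ⟨hx, h⟩

theorem of_intervals {C : Set ℚ}
    (h : ∀ x ∈ C, ∀ y ∈ C, x ≤ y → HereditarilyDecomposable (C ∩ Set.Icc x y)) :
    HereditarilyDecomposable C := by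
  intro D hD
  rcases D.eq_empty_or_nonempty with rfl | ⟨x, hx⟩
  · exact decomposable_empty
  have hsplit : D = D ∩ Set.Iio x ∪ D ∩ Set.Ici x := by
    rw [← Set.inter_union_distrib_left, Set.Iio_union_Ici, Set.inter_univ]
  rw [hsplit]
  refine Decomposable.union (Decomposable.of_bounded false ?_) (Decomposable.of_bounded true ?_)
    fun y hy z hz => lt_of_lt_of_le hy.2 hz.2
  · rintro y ⟨hy, hyx⟩ E hE hyE
    refine h y (hD hy) x (hD hx) (le_of_lt hyx) E fun z hz => ⟨hD (hE hz).1, ?_, ?_⟩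
    · exact not_lt.1 (hyE z hz)
    · exact le_of_lt (hE hz).2
  · rintro y ⟨hy, hyx⟩ E hE hyE
    refine h x (hD hx) y (hD hy) hyx E fun z hz => ⟨hD (hE hz).1, (hE hz).2, ?_⟩
    exact not_lt.1 (hyE z hz)

theorem uIcc_trans {A : Set ℚ} {x y z : ℚ} (hxy : HereditarilyDecomposable (A ∩ Set.uIcc x y))
    (hyz : HereditarilyDecomposable (A ∩ Set.uIcc y z)) :
    HereditarilyDecomposable (A ∩ Set.uIcc x z) := by
  rcases le_total x z with h | h
  · refine of_split y (hxy.mono ?_) (hyz.mono ?_)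
    · rintro w ⟨⟨hw, hwxz⟩, hwy⟩
      rw [Set.uIcc_of_le h] at hwxz
      exact ⟨hw, Set.Icc_subset_uIcc ⟨hwxz.1, le_of_lt hwy⟩⟩
    · rintro w ⟨⟨hw, hwxz⟩, hwy⟩
      rw [Set.uIcc_of_le h] at hwxz
      exact ⟨hw, Set.Icc_subset_uIcc ⟨hwy, hwxz.2⟩⟩
  · refine of_split y (hyz.mono ?_) (hxy.mono ?_)
    · rintro w ⟨⟨hw, hwxz⟩, hwy⟩
      rw [Set.uIcc_of_ge h] at hwxz
      exact ⟨hw, Set.Icc_subset_uIcc' ⟨hwxz.1, le_of_lt hwy⟩⟩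
    · rintro w ⟨⟨hw, hwxz⟩, hwy⟩
      rw [Set.uIcc_of_ge h] at hwxz
      exact ⟨hw, Set.Icc_subset_uIcc' ⟨hwy, hwxz.2⟩⟩

theorem of_subsingleton {A : Set ℚ} (hA : A.Subsingleton) : HereditarilyDecomposable A :=
  fun _ hB => Decomposable.of_subsingleton (hA.anti hB)

/-- The condensation of `A` identifying points whose interval is hereditarily decomposable. -/
def setoid (A : Set ℚ) : Setoid A where
  r x y := HereditarilyDecomposable (A ∩ Set.uIcc (x : ℚ) y)
  iseqv :=
    { refl := fun x => of_subsingleton (by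
        rw [Set.uIcc_self]
        exact Set.subsingleton_singleton.anti Set.inter_subset_right)
      symm := fun {x y} h => by rwa [Set.uIcc_comm]
      trans := fun h h' => uIcc_trans h h' }

/-- If every point of `A` between `x` and `y` is equivalent to `x` or to `y`, then so are `x`
and `y` to each other. -/
theorem of_forall_or {A : Set ℚ} {x y : ℚ} (hxy : x ≤ y)
    (h : ∀ z ∈ A ∩ Set.Icc x y, HereditarilyDecomposable (A ∩ Set.uIcc x z) ∨
      HereditarilyDecomposable (A ∩ Set.uIcc z y)) :
    HereditarilyDecomposable (A ∩ Set.uIcc x y) := by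
  rw [Set.uIcc_of_le hxy]
  let P : Set ℚ := {z | HereditarilyDecomposable (A ∩ Set.uIcc x z)}
  have hlow : HereditarilyDecomposable ((A ∩ Set.Icc x y) ∩ P) := by
    refine of_intervals fun u hu v hv huv => ?_
    have hux : HereditarilyDecomposable (A ∩ Set.uIcc u x) := by
      rw [Set.uIcc_comm]
      exact hu.2
    refine (uIcc_trans hux hv.2).mono ?_
    rintro w ⟨⟨hw, -⟩, hwuv⟩
    exact ⟨hw.1, Set.Icc_subset_uIcc hwuv⟩
  have hhigh : HereditarilyDecomposable ((A ∩ Set.Icc x y) ∩ Pᶜ) := by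
    refine of_intervals fun u hu v hv huv => ?_
    have huy := (h u hu.1).resolve_left hu.2
    have hvy := (h v hv.1).resolve_left hv.2
    rw [Set.uIcc_comm] at hvy
    refine (uIcc_trans huy hvy).mono ?_
    rintro w ⟨⟨hw, -⟩, hwuv⟩
    exact ⟨hw.1, Set.Icc_subset_uIcc hwuv⟩
  refine (hlow.union hhigh fun u hu v hv => lt_of_not_ge fun hvu => hv.2 ?_).mono ?_
  · refine mono hu.2 (Set.inter_subset_inter_right _ ?_)
    rw [Set.uIcc_of_le hv.1.2.1, Set.uIcc_of_le hu.1.2.1]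
    exact Set.Icc_subset_Icc_right hvu
  · rw [← Set.inter_union_distrib_left, Set.union_compl_self, Set.inter_univ]

/-- A choice of representatives of the condensation of `A`. -/
theorem exists_rep (A : Set ℚ) : ∃ rep : Quotient (setoid A) → ℚ, (∀ q, rep q ∈ A) ∧
    (∀ p q, HereditarilyDecomposable (A ∩ Set.uIcc (rep p) (rep q)) → p = q) ∧
    ∀ z ∈ A, ∃ q, HereditarilyDecomposable (A ∩ Set.uIcc z (rep q)) := by
  refine ⟨fun q => (q.out).1, fun q => (q.out).2, fun p q h => ?_, fun z hz => ?_⟩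
  · rw [← p.out_eq, ← q.out_eq]
    exact Quotient.sound (s := setoid A) h
  · refine ⟨Quotient.mk (setoid A) ⟨z, hz⟩, ?_⟩
    rw [Set.uIcc_comm]
    exact Quotient.mk_out (s := setoid A) ⟨z, hz⟩

end HereditarilyDecomposable

open HereditarilyDecomposable in
/-- A set of rationals into which `ℚ` does not embed is decomposable. -/
theorem decomposable_of_not_embeds {A : Set ℚ} (hA : ¬ Embeds Set.univ A) : Decomposable A := by
  obtain ⟨rep, hrepA, hrep, hex⟩ := exists_rep A
  let S : Set ℚ := Set.range rep
  by_cases hone : ∀ p q : Quotient (setoid A), p = q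
  · refine of_intervals (fun x hx y hy hxy => ?_) A subset_rfl
    obtain ⟨p, hp⟩ := hex x hx
    obtain ⟨q, hq⟩ := hex y hy
    rw [Set.uIcc_comm, hone q p] at hq
    rw [← Set.uIcc_of_le hxy]
    exact uIcc_trans hp hq
  exfalso
  push Not at hone
  obtain ⟨p, q, hpq⟩ := hone
  have hinj : Function.Injective rep := fun p q h => hrep p q (by
    rw [h, Set.uIcc_self]
    exact of_subsingleton (Set.subsingleton_singleton.anti Set.inter_subset_right))
  have : Nontrivial S := ⟨⟨rep p, p, rfl⟩, ⟨rep q, q, rfl⟩, fun h =>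
    hpq (hinj (congrArg Subtype.val h))⟩
  have : DenselyOrdered S := by
    refine ⟨?_⟩
    rintro ⟨_, p, rfl⟩ ⟨_, q, rfl⟩ hpq
    replace hpq : rep p < rep q := hpq
    have hz : ∃ z ∈ A ∩ Set.Icc (rep p) (rep q),
        ¬ HereditarilyDecomposable (A ∩ Set.uIcc (rep p) z) ∧
        ¬ HereditarilyDecomposable (A ∩ Set.uIcc z (rep q)) := by
      by_contra! h
      refine hpq.ne (congrArg rep (hrep p q (of_forall_or hpq.le fun z hz => ?_)))
      exact or_iff_not_imp_left.2 (h z hz)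
    obtain ⟨z, ⟨hzA, hpz, hzq⟩, h₁, h₂⟩ := hz
    obtain ⟨r, hr⟩ := hex z hzA
    refine ⟨⟨rep r, r, rfl⟩, ?_, ?_⟩
    · refine lt_of_not_ge fun hle => h₁ (hr.mono (Set.inter_subset_inter_right _ ?_))
      replace hle : rep r ≤ rep p := hle
      rw [Set.uIcc_of_le hpz, Set.uIcc_of_ge (hle.trans hpz)]
      exact Set.Icc_subset_Icc_left hle
    · refine lt_of_not_ge fun hle => h₂ (hr.mono (Set.inter_subset_inter_right _ ?_))
      replace hle : rep q ≤ rep r := hle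
      rw [Set.uIcc_of_le hzq, Set.uIcc_of_le (hzq.trans hle)]
      exact Set.Icc_subset_Icc_right hle
  obtain ⟨f⟩ := Order.embedding_from_countable_to_dense ℚ S
  refine hA ⟨fun x => f x, fun x _ y _ hxy => f.strictMono hxy, fun x _ => ?_⟩
  obtain ⟨q, hq⟩ := (f x).2
  exact Set.mem_of_eq_of_mem hq.symm (hrepA q)

/-! ### Embeddability of sets of rationals is a well-quasi-order -/

/-- Every set embedding into the order of `s` embeds into the order of `t`. -/
def Dominated (s t : SignedTree) : Prop :=
  ∀ A, EmbedsInto s A → EmbedsInto t A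

instance : IsPreorder SignedTree Dominated where
  refl _ _ h := h
  trans _ _ _ h h' A hA := h' A (h A hA)

theorem Decomposes.embeds {l l' : List SignedTree} (h : List.SublistForall₂ Dominated l l')
    {A B : Set ℚ} (hA : Decomposes l A) (hB : Decomposes l' B) : Embeds A B := by
  classical
  induction h generalizing A B with
  | nil =>
    obtain rfl : A = ∅ := hA
    exact ⟨id, strictMono_id.strictMonoOn _, Set.mapsTo_empty _ _⟩
  | cons hst _ ih =>
    obtain ⟨A₁, A₂, rfl, hA12, hA₁, hA₂⟩ := hA
    obtain ⟨B₁, B₂, rfl, hB12, hB₁, hB₂⟩ := hB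
    obtain ⟨f, hf, hfB⟩ := (hst A₁ hA₁.1).embeds hB₁.2
    obtain ⟨g, hg, hgB⟩ := ih hA₂ hB₂
    have hnot : ∀ x ∈ A₂, x ∉ A₁ := fun x hx hx₁ => lt_irrefl x (hA12 x hx₁ x hx)
    refine ⟨fun x => if x ∈ A₁ then f x else g x, ?_, ?_⟩
    · rintro x (hx | hx) y (hy | hy) hxy
      · simpa [hx, hy] using hf hx hy hxy
      · simpa [hx, hnot y hy] using hB12 _ (hfB hx) _ (hgB hy)
      · exact absurd hxy (not_lt_of_gt (hA12 y hy x hx))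
      · simpa [hnot x hx, hnot y hy] using hg hx hy hxy
    · rintro x (hx | hx)
      · simpa [hx] using Or.inl (hfB hx)
      · simpa [hnot x hx] using Or.inr (hgB hx)
  | cons_right _ ih =>
    obtain ⟨B₁, B₂, rfl, -, -, hB₂⟩ := hB
    obtain ⟨f, hf, hfB⟩ := ih hA hB₂
    exact ⟨f, hf, hfB.mono_right Set.subset_union_right⟩

/-- Embeddability of countable linear orders is a well-quasi-order. -/
theorem wellQuasiOrdered_embeds : WellQuasiOrdered Embeds := by
  intro A
  by_cases h : ∃ m, Embeds Set.univ (A (m + 1))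
  · obtain ⟨m, f, hf, hfA⟩ := h
    exact ⟨0, m + 1, m.succ_pos, f, hf.mono (Set.subset_univ _),
      hfA.mono_left (Set.subset_univ _)⟩
  push Not at h
  choose l hl using fun m => decomposable_of_not_embeds (h m)
  have hdom : WellQuasiOrdered Dominated := fun T => by
    obtain ⟨m, n, hmn, hle⟩ := wellQuasiOrdered_le T
    exact ⟨m, n, hmn, fun _ hA => hA.of_le hle⟩
  have hlist := Set.PartiallyWellOrderedOn.partiallyWellOrderedOn_sublistForall₂ Dominated
    (Set.partiallyWellOrderedOn_univ_iff.2 hdom)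
  obtain ⟨m, n, hmn, hle⟩ := hlist.exists_lt (f := l) fun _ _ _ => Set.mem_univ _
  exact ⟨m + 1, n + 1, Nat.succ_lt_succ hmn, (hl m).embeds hle (hl n)⟩

end SignedTree

/-! ### Cutting circular orders -/

namespace CircularOrder

variable {α β : Type*} [CircularOrder α] [CircularOrder β]

/-- The strict linear order obtained by cutting a circular order just before `o`. -/
def CutLT (o x y : α) : Prop :=
  (x = o ∧ y ≠ o) ∨ sbtw o x y

theorem not_cutLT_self (o x : α) : ¬ CutLT o x x := by
  rintro (⟨h, h'⟩ | h)
  · exact h' h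
  · exact sbtw_irrefl_right h

theorem CutLT.sbtw {o x y z : α} (hxy : CutLT o x y) (hyz : CutLT o y z) : sbtw x y z := by
  rcases hyz with ⟨rfl, -⟩ | hyz
  · rcases hxy with ⟨-, h⟩ | h
    · exact absurd rfl h
    · exact absurd h sbtw_irrefl_left_right
  · rcases hxy with ⟨rfl, -⟩ | hxy
    · exact hyz
    · exact (hyz.cyclic_left.trans_right hxy.cyclic_right).cyclic_right

theorem CutLT.trans {o x y z : α} (hxy : CutLT o x y) (hyz : CutLT o y z) : CutLT o x z := by
  rcases hyz with ⟨rfl, -⟩ | hyz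
  · rcases hxy with ⟨-, h⟩ | h
    · exact absurd rfl h
    · exact absurd h sbtw_irrefl_left_right
  · rcases hxy with ⟨rfl, -⟩ | hxy
    · exact Or.inl ⟨rfl, fun h => sbtw_irrefl_left_right (h ▸ hyz)⟩
    · exact Or.inr (hxy.trans_right hyz)

theorem sbtw_of_btw {x y z : α} (h : btw x y z) (hxy : x ≠ y) (hyz : y ≠ z) (hzx : z ≠ x) :
    sbtw x y z :=
  h.sbtw_of_not_btw fun h' => by
    rcases h.antisymm h' with h | h | h
    exacts [hxy h, hyz h, hzx h]

theorem cutLT_total (o : α) {x y : α} (hxy : x ≠ y) : CutLT o x y ∨ CutLT o y x := by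
  by_cases hx : x = o
  · exact Or.inl (Or.inl ⟨hx, fun hy => hxy (hx.trans hy.symm)⟩)
  by_cases hy : y = o
  · exact Or.inr (Or.inl ⟨hy, hx⟩)
  rcases btw_total o x y with h | h
  · exact Or.inl (Or.inr (sbtw_of_btw h (Ne.symm hx) hxy hy))
  · exact Or.inr (Or.inr (sbtw_of_btw h.cyclic_right (Ne.symm hy) hxy.symm hx))

/-- A countable circular order is represented in `ℚ`. -/
theorem exists_cut [Countable α] (o : α) : ∃ e : α → ℚ, Function.Injective e ∧
    ∀ x y z, e x < e y → e y < e z → sbtw x y z := by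
  classical
  have : IsStrictTotalOrder α (CutLT o) :=
    { trichotomous := fun x y hxy hyx => by
        by_contra hne
        exact (cutLT_total o hne).elim hxy hyx
      irrefl := not_cutLT_self o
      trans := fun _ _ _ h h' => h.trans h' }
  let _ := linearOrderOfSTO (CutLT o)
  obtain ⟨e⟩ := Order.embedding_from_countable_to_dense α ℚ
  refine ⟨e, e.injective, fun x y z hxy hyz => ?_⟩
  exact CutLT.sbtw (o := o) (e.lt_iff_lt.1 hxy) (e.lt_iff_lt.1 hyz)

/-- A map that is increasing for linear representations preserves betweenness. -/
theorem btw_map {e : α → ℚ} {e' : β → ℚ} (hinj : Function.Injective e)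
    (he : ∀ x y z, e x < e y → e y < e z → sbtw x y z)
    (he' : ∀ x y z, e' x < e' y → e' y < e' z → sbtw x y z) {f : α → β}
    (hf : ∀ x y, e x < e y → e' (f x) < e' (f y)) {x y z : α} (h : btw x y z) :
    btw (f x) (f y) (f z) := by
  have key : ∀ a b c, e a < e b → e b < e c → btw (f a) (f b) (f c) := fun a b c hab hbc =>
    (he' _ _ _ (hf _ _ hab) (hf _ _ hbc)).btw
  by_cases hxy : x = y
  · exact hxy ▸ btw_rfl_left
  by_cases hyz : y = z
  · exact hyz ▸ btw_rfl_right
  by_cases hzx : z = x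
  · exact hzx ▸ btw_rfl_left_right
  have hno := (sbtw_of_btw h hxy hyz hzx).not_sbtw
  rcases lt_or_gt_of_ne (hinj.ne hxy) with h₁ | h₁ <;>
    rcases lt_or_gt_of_ne (hinj.ne hyz) with h₂ | h₂ <;>
    rcases lt_or_gt_of_ne (hinj.ne hzx) with h₃ | h₃
  · exact key _ _ _ h₁ h₂
  · exact key _ _ _ h₁ h₂
  · exact (key _ _ _ h₃ h₁).cyclic_left
  · exact absurd (he _ _ _ h₃ h₂).cyclic_left hno
  · exact (key _ _ _ h₂ h₃).cyclic_right
  · exact absurd (he _ _ _ h₁ h₃).cyclic_right hno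
  · exact absurd (he _ _ _ h₂ h₁) hno
  · exact absurd (he _ _ _ h₂ h₁) hno

end CircularOrder

/-- Embeddability of countable circular orders is a well-quasi-order: in any
sequence of circular orders on `ℕ` there are `n < m` such that the `n`-th one
embeds into the `m`-th one. -/
theorem circularOrder_embeddability_wqo (C : ℕ → CircularOrder ℕ) :
    ∃ n m : ℕ, n < m ∧ ∃ f : ℕ → ℕ, Function.Injective f ∧
      ∀ x y z : ℕ, cobtw (C n) x y z → cobtw (C m) (f x) (f y) (f z) := by
  choose e hinj he using fun n => @CircularOrder.exists_cut ℕ (C n) _ 0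
  obtain ⟨n, m, hnm, g, hg, hmaps⟩ :=
    SignedTree.wellQuasiOrdered_embeds fun n => Set.range (e n)
  choose f hf using fun x => hmaps (Set.mem_range_self (f := e n) x)
  have hmono : ∀ x y, e n x < e n y → e m (f x) < e m (f y) := fun x y hxy => by
    rw [hf, hf]
    exact hg (Set.mem_range_self x) (Set.mem_range_self y) hxy
  refine ⟨n, m, hnm, f, fun x y hxy => ?_, fun x y z h => ?_⟩
  · refine hinj n (hg.injOn (Set.mem_range_self x) (Set.mem_range_self y) ?_)
    rw [← hf, ← hf, hxy]
  · exact @CircularOrder.btw_map ℕ ℕ (C n) (C m) _ _ (hinj n) (he n) (he m) _ hmono _ _ _ h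
end

section
/- For all linear orders L and L' on ℕ, the circular order C[1 + ζL] is isomorphic to the circular order C[1 + ζL'] if and only if L is order-isomorphic to L'. Here an isomorphism of circular orders C[M] and C[M'] is a bijection g between the underlying sets such that C[M](x,y,z) holds if and only if C[M'](g x, g y, g z) holds, for all x, y, z. -/
/-- The order relation of `1 + ζL`: the lexicographic sum of a one-point order
followed by `ζL`, where `ζL` is the lexicographic order on `L × ℤ`
(`L`-coordinate first). -/
def oneZetaLe (L : LinearOrder ℕ) :
    (PUnit ⊕ ℕ × ℤ) → (PUnit ⊕ ℕ × ℤ) → Prop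
  | Sum.inl _, _ => True
  | Sum.inr _, Sum.inl _ => False
  | Sum.inr p, Sum.inr q => L.lt p.1 q.1 ∨ (p.1 = q.1 ∧ p.2 ≤ q.2)

/-- The circular order `C[M]` induced by a linear (order) relation `le`:
`C[M](x,y,z)` iff `x ≤ y ≤ z` or `y ≤ z ≤ x` or `z ≤ x ≤ y`. -/
def circRel {β : Type*} (le : β → β → Prop) (x y z : β) : Prop :=
  (le x y ∧ le y z) ∨ (le y z ∧ le z x) ∨ (le z x ∧ le x y)

/-- `L` and `L'` are order-isomorphic linear orders on `ℕ`. -/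
def IsoNat (L L' : LinearOrder ℕ) : Prop :=
  ∃ f : ℕ ≃ ℕ, ∀ a b : ℕ, L.le a b ↔ L'.le (f a) (f b)

section Zeta

variable {α β : Type*} [LinearOrder α] [LinearOrder β]

/-- An order isomorphism from `ζα` to `ζβ` maps successive elements of a copy of `ℤ` into the same
copy of `ℤ`. -/
theorem fst_orderIso_add_one (h : α ×ₗ ℤ ≃o β ×ₗ ℤ) (a : α) (n : ℤ) :
    (ofLex (h (toLex (a, n + 1)))).1 = (ofLex (h (toLex (a, n)))).1 := by
  set q := h (toLex (a, n)) with hq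
  have lower : q ≤ h (toLex (a, n + 1)) := by
    rw [hq, h.le_iff_le, Prod.Lex.toLex_le_toLex]
    exact Or.inr ⟨rfl, by simp⟩
  have upper : h (toLex (a, n + 1)) ≤ toLex ((ofLex q).1, (ofLex q).2 + 1) := by
    have hlt : q < toLex ((ofLex q).1, (ofLex q).2 + 1) := by
      rw [Prod.Lex.lt_iff]
      exact Or.inr ⟨rfl, by simp⟩
    rw [← h.le_symm_apply]
    rw [hq, ← h.lt_symm_apply, ← hq, Prod.Lex.lt_iff] at hlt
    rw [Prod.Lex.le_iff]
    exact hlt.imp id fun H => ⟨H.1, H.2⟩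
  have fst_le := Prod.Lex.monotone_fst _ _ upper
  exact le_antisymm fst_le (Prod.Lex.monotone_fst _ _ lower)

theorem fst_orderIso_eq (h : α ×ₗ ℤ ≃o β ×ₗ ℤ) (a : α) (m n : ℤ) :
    (ofLex (h (toLex (a, m)))).1 = (ofLex (h (toLex (a, n)))).1 := by
  suffices H : ∀ k : ℤ, (ofLex (h (toLex (a, k)))).1 = (ofLex (h (toLex (a, 0)))).1 by
    rw [H m, H n]
  intro k
  induction k using Int.induction_on with
  | zero => rfl
  | succ i ih => rw [fst_orderIso_add_one, ih]
  | pred i ih => rw [← ih, ← fst_orderIso_add_one, sub_add_cancel]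

theorem fst_symm_fst_orderIso (h : α ×ₗ ℤ ≃o β ×ₗ ℤ) (a : α) :
    (ofLex (h.symm (toLex ((ofLex (h (toLex (a, 0)))).1, 0)))).1 = a := by
  rw [fst_orderIso_eq h.symm _ 0 (ofLex (h (toLex (a, 0)))).2]
  simp

theorem monotone_fst_orderIso (h : α ×ₗ ℤ ≃o β ×ₗ ℤ) :
    Monotone fun a => (ofLex (h (toLex (a, 0)))).1 := fun a b hab =>
  Prod.Lex.monotone_fst _ _ <| h.monotone <| by
    rw [Prod.Lex.toLex_le_toLex]
    exact hab.lt_or_eq.imp id fun H => ⟨H, le_rfl⟩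

/-- The order type of `α` is determined by that of `ζα`. -/
theorem nonempty_orderIso_of_lex_int (h : α ×ₗ ℤ ≃o β ×ₗ ℤ) : Nonempty (α ≃o β) :=
  ⟨Equiv.toOrderIso
    { toFun := fun a => (ofLex (h (toLex (a, 0)))).1
      invFun := fun b => (ofLex (h.symm (toLex (b, 0)))).1
      left_inv := fst_symm_fst_orderIso h
      right_inv := fst_symm_fst_orderIso h.symm }
    (monotone_fst_orderIso h) (monotone_fst_orderIso h.symm)⟩

end Zeta

theorem nonempty_orderIso_of_lex_equiv {α β : Type*} [LinearOrder α] [LinearOrder β]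
    (e : α × ℤ ≃ β × ℤ)
    (he : ∀ p q : α × ℤ, (p.1 < q.1 ∨ p.1 = q.1 ∧ p.2 ≤ q.2) ↔
      ((e p).1 < (e q).1 ∨ (e p).1 = (e q).1 ∧ (e p).2 ≤ (e q).2)) :
    Nonempty (α ≃o β) :=
  nonempty_orderIso_of_lex_int
    { toEquiv := ofLex.trans (e.trans toLex)
      map_rel_iff' := by
        intro p q
        rw [Prod.Lex.le_iff, Prod.Lex.le_iff]
        exact (he (ofLex p) (ofLex q)).symm }

section Circular

variable (L L' : LinearOrder ℕ)

theorem circRel_inl_inr_inr (u : PUnit) (p q : ℕ × ℤ) :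
    circRel (oneZetaLe L) (Sum.inl u) (Sum.inr p) (Sum.inr q) ↔
      L.lt p.1 q.1 ∨ (p.1 = q.1 ∧ p.2 ≤ q.2) := by
  simp [circRel, oneZetaLe]

/-- In `C[1 + ζL]` the extra point has no immediate successor. -/
theorem exists_not_circRel_inl (u : PUnit) (y : PUnit ⊕ ℕ × ℤ) (hy : y ≠ Sum.inl u) :
    ∃ z, ¬ circRel (oneZetaLe L) (Sum.inl u) y z := by
  rcases y with v | ⟨a, n⟩
  · exact absurd rfl hy
  · refine ⟨Sum.inr (a, n - 1), ?_⟩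
    rw [circRel_inl_inr_inr]
    rintro (h | h)
    · exact @lt_irrefl ℕ L.toPreorder a h
    · have := h.2
      simp at this

/-- In `C[1 + ζL]` the point `(a, n + 1)` is the immediate successor of `(a, n)`. -/
theorem circRel_inr_add_one (a : ℕ) (n : ℤ) (z : PUnit ⊕ ℕ × ℤ) :
    circRel (oneZetaLe L) (Sum.inr (a, n)) (Sum.inr (a, n + 1)) z := by
  rcases z with v | ⟨b, m⟩
  · simp [circRel, oneZetaLe]
  · rcases @lt_trichotomy ℕ L a b with h | rfl | h
    · exact Or.inl ⟨Or.inr ⟨rfl, by simp⟩, Or.inl h⟩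
    · rcases lt_or_ge n m with h | h
      · exact Or.inl ⟨Or.inr ⟨rfl, by simp⟩, Or.inr ⟨rfl, h⟩⟩
      · exact Or.inr (Or.inr ⟨Or.inr ⟨rfl, h⟩, Or.inr ⟨rfl, by simp⟩⟩)
    · exact Or.inr (Or.inr ⟨Or.inl h, Or.inr ⟨rfl, by simp⟩⟩)

variable {L L'}

/-- An isomorphism of circular orders sends no point of `ζL` to the extra point. -/
theorem exists_apply_inr_eq_inr (g : (PUnit ⊕ ℕ × ℤ) ≃ (PUnit ⊕ ℕ × ℤ))
    (hg : ∀ x y z, circRel (oneZetaLe L) x y z ↔ circRel (oneZetaLe L') (g x) (g y) (g z))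
    (p : ℕ × ℤ) : ∃ q, g (Sum.inr p) = Sum.inr q := by
  obtain ⟨a, n⟩ := p
  rcases hu : g (Sum.inr (a, n)) with u | q
  · obtain ⟨z, hz⟩ := exists_not_circRel_inl L' u (g (Sum.inr (a, n + 1))) (by
      rw [← hu, g.injective.ne_iff]
      simp)
    have := (hg _ _ (g.symm z)).1 (circRel_inr_add_one L a n (g.symm z))
    rw [hu, g.apply_symm_apply] at this
    exact absurd this hz
  · exact ⟨q, rfl⟩

theorem isoNat_of_circRel_equiv (g : (PUnit ⊕ ℕ × ℤ) ≃ (PUnit ⊕ ℕ × ℤ))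
    (hg : ∀ x y z, circRel (oneZetaLe L) x y z ↔ circRel (oneZetaLe L') (g x) (g y) (g z)) :
    IsoNat L L' := by
  have hg' : ∀ x y z, circRel (oneZetaLe L') x y z ↔
      circRel (oneZetaLe L) (g.symm x) (g.symm y) (g.symm z) := fun x y z => by
    simp [hg]
  choose e he using exists_apply_inr_eq_inr g hg
  choose e' he' using exists_apply_inr_eq_inr g.symm hg'
  have hinl : g (Sum.inl PUnit.unit) = Sum.inl PUnit.unit := by
    rcases hu : g (Sum.inl PUnit.unit) with u | q
    · rfl
    · have := he' q
      rw [← hu, g.symm_apply_apply] at this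
      simp at this
  let E : ℕ × ℤ ≃ ℕ × ℤ :=
    { toFun := e
      invFun := e'
      left_inv := fun p => Sum.inr_injective (by rw [← he', ← he, g.symm_apply_apply])
      right_inv := fun p => Sum.inr_injective (by rw [← he, ← he', g.apply_symm_apply]) }
  obtain ⟨f⟩ := @nonempty_orderIso_of_lex_equiv ℕ ℕ L L' E fun p q => by
    have := hg (Sum.inl PUnit.unit) (Sum.inr p) (Sum.inr q)
    rw [hinl, he, he, circRel_inl_inr_inr, circRel_inl_inr_inr] at this
    exact this
  exact ⟨f.toEquiv, fun a b => f.map_rel_iff.symm⟩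

theorem oneZetaLe_sumCongr_iff (f : ℕ ≃ ℕ) (hf : ∀ a b : ℕ, L.le a b ↔ L'.le (f a) (f b))
    (x y : PUnit ⊕ ℕ × ℤ) :
    oneZetaLe L x y ↔ oneZetaLe L'
      (Equiv.sumCongr Equiv.punitEquivPUnit (f.prodCongr (Equiv.refl ℤ)) x)
      (Equiv.sumCongr Equiv.punitEquivPUnit (f.prodCongr (Equiv.refl ℤ)) y) := by
  have hlt : ∀ a b : ℕ, L.lt a b ↔ L'.lt (f a) (f b) := fun a b => by
    rw [L.lt_iff_le_not_ge, L'.lt_iff_le_not_ge, hf, hf]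
  rcases x with u | p <;> rcases y with v | q <;> simp [oneZetaLe, hlt]

end Circular


/-- For linear orders `L, L'` on `ℕ`, the circular orders `C[1 + ζL]` and
`C[1 + ζL']` are isomorphic iff `L` and `L'` are order-isomorphic. -/
theorem circ_oneZeta_iso_iff (L L' : LinearOrder ℕ) :
    (∃ g : (PUnit ⊕ ℕ × ℤ) ≃ (PUnit ⊕ ℕ × ℤ),
      ∀ x y z : PUnit ⊕ ℕ × ℤ,
        circRel (oneZetaLe L) x y z ↔ circRel (oneZetaLe L') (g x) (g y) (g z)) ↔
    IsoNat L L' := by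
  constructor
  · rintro ⟨g, hg⟩
    exact isoNat_of_circRel_equiv g hg
  · rintro ⟨f, hf⟩
    refine ⟨Equiv.sumCongr Equiv.punitEquivPUnit (f.prodCongr (Equiv.refl ℤ)), fun x y z => ?_⟩
    simp only [circRel, ← oneZetaLe_sumCongr_iff f hf]
end
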